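/- arXiv:2509.00627 — 5 statements merged into one kernel-verified Lean document; each statement's English description precedes it below -/
import Mathlib

section
/- Let U be a finite nonempty type and let A and B be nonempty finite subsets of U. If σ is a uniformly random permutation of U (drawn uniformly from all bijections of U), then the probability that min over u ∈ A of σ's rank of u equals min over u ∈ B of σ's rank of u (where ranks are taken in any fixed linear order on U, e.g. σ composed with an enumeration U ≃ {1,…,|U|}) is exactly |A ∩ B| / |A ∪ B|. -/
open Finset in
/-- Over a fixed nonempty finset, each element is equally likely to be the minimizer of a random
permutation. -/
theorem card_perm_minimizer_eq {U : Type*} [Fintype U] [LinearOrder U] {S : Finset U} {u w : U}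
    (hu : u ∈ S) (hw : w ∈ S) :
    #{σ : Equiv.Perm U | ∀ v ∈ S, σ u ≤ σ v} = #{σ : Equiv.Perm U | ∀ v ∈ S, σ w ≤ σ v} := by
  have swap_mem : ∀ v ∈ S, Equiv.swap u w v ∈ S := fun v hv => by
    rw [Equiv.swap_apply_def]; split_ifs <;> assumption
  refine card_equiv (Equiv.mulRight (Equiv.swap u w)) fun σ => ?_
  simp only [mem_filter_univ, Equiv.coe_mulRight, Equiv.Perm.mul_apply, Equiv.swap_apply_right]
  exact ⟨fun h v hv => h _ (swap_mem v hv), fun h v hv => by simpa using h _ (swap_mem v hv)⟩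

open Finset in
/-- The number of permutations whose minimum over `S` is attained in `T ⊆ S`. -/
theorem card_perm_exists_minimizer {U : Type*} [Fintype U] [LinearOrder U] {S T : Finset U}
    (hTS : T ⊆ S) {w : U} (hw : w ∈ S) :
    #{σ : Equiv.Perm U | ∃ u ∈ T, ∀ v ∈ S, σ u ≤ σ v} =
      #T * #{σ : Equiv.Perm U | ∀ v ∈ S, σ w ≤ σ v} := by
  have h_union : ({σ : Equiv.Perm U | ∃ u ∈ T, ∀ v ∈ S, σ u ≤ σ v} : Finset _) =
      T.biUnion fun u => {σ : Equiv.Perm U | ∀ v ∈ S, σ u ≤ σ v} := by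
    ext σ; simp
  rw [h_union, card_biUnion]
  · exact sum_const_nat fun u hu => card_perm_minimizer_eq (hTS hu) hw
  · intro x hx y hy hxy
    refine disjoint_filter.2 fun σ _ h₁ h₂ => hxy (σ.injective ?_)
    exact le_antisymm (h₁ y (hTS hy)) (h₂ x (hTS hx))

open Finset in
/-- Two sets have the same minimum under an injection iff the minimum over their union is attained
in their intersection. -/
theorem min'_image_eq_iff_exists_mem_inter {α β : Type*} [DecidableEq α] [LinearOrder β]
    {f : α → β} (hf : Function.Injective f) {A B : Finset α} (hA : A.Nonempty)
    (hB : B.Nonempty) :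
    (A.image f).min' (hA.image f) = (B.image f).min' (hB.image f) ↔
      ∃ u ∈ A ∩ B, ∀ v ∈ A ∪ B, f u ≤ f v := by
  constructor
  · intro h
    obtain ⟨a, ha, hfa⟩ := mem_image.1 ((A.image f).min'_mem (hA.image f))
    obtain ⟨b, hb, hfb⟩ := mem_image.1 ((B.image f).min'_mem (hB.image f))
    obtain rfl : a = b := hf (hfa.trans (h.trans hfb.symm))
    refine ⟨a, mem_inter.2 ⟨ha, hb⟩, fun v hv => ?_⟩
    rcases mem_union.1 hv with hv | hv
    · exact hfa.trans_le (min'_le _ _ (mem_image_of_mem f hv))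
    · exact hfb.trans_le (min'_le _ _ (mem_image_of_mem f hv))
  · rintro ⟨u, hu, hmin⟩
    have min_eq : ∀ {C : Finset α} (hC : C.Nonempty), u ∈ C → C ⊆ A ∪ B →
        (C.image f).min' (hC.image f) = f u := fun hC huC hCsub =>
      le_antisymm (min'_le _ _ (mem_image_of_mem f huC))
        (le_min' _ _ _ (forall_mem_image.2 fun v hv => hmin v (hCsub hv)))
    rw [min_eq hA (mem_inter.1 hu).1 subset_union_left,
      min_eq hB (mem_inter.1 hu).2 subset_union_right]

/-- **Min-hash property.** For a uniformly random permutation `σ` of a finite nonempty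
type `U` (with a fixed linear order used to compare ranks), the probability that the
minimum of `σ` over a nonempty finite set `A` equals the minimum of `σ` over a nonempty
finite set `B` is exactly `|A ∩ B| / |A ∪ B|`. -/
theorem minhash_collision_probability {U : Type*} [Fintype U] [Nonempty U] [LinearOrder U]
    (A B : Finset U) (hA : A.Nonempty) (hB : B.Nonempty) :
    ((Finset.univ.filter fun σ : Equiv.Perm U =>
        (A.image ⇑σ).min' (hA.image ⇑σ) = (B.image ⇑σ).min' (hB.image ⇑σ)).card : ℝ)
      / (Fintype.card (Equiv.Perm U) : ℝ)
    = ((A ∩ B).card : ℝ) / ((A ∪ B).card : ℝ) := by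
  obtain ⟨w, hw⟩ : (A ∪ B).Nonempty := hA.mono Finset.subset_union_left
  have h_total : Fintype.card (Equiv.Perm U) = (A ∪ B).card *
      (Finset.univ.filter fun σ : Equiv.Perm U => ∀ v ∈ A ∪ B, σ w ≤ σ v).card := by
    rw [← card_perm_exists_minimizer subset_rfl hw, ← Finset.card_univ]
    refine (Finset.card_filter_eq_iff.2 fun σ _ => ?_).symm
    exact (A ∪ B).exists_min_image σ ⟨w, hw⟩
  have h_pos : 0 < Fintype.card (Equiv.Perm U) := Fintype.card_pos
  rw [h_total] at h_pos ⊢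
  simp_rw [min'_image_eq_iff_exists_mem_inter (Equiv.injective _) hA hB]
  rw [card_perm_exists_minimizer
    (Finset.inter_subset_left.trans Finset.subset_union_left) hw]
  push_cast
  exact mul_div_mul_right _ _ (Nat.cast_ne_zero.2 (Nat.pos_of_mul_pos_left h_pos).ne')
end

section
/- For any text T of length n, any injective hash function h, and any indices 1 ≤ i ≤ j ≤ n, the min-hash of the subsequence equals the smallest hash value over its keys: h(T[i,j]) = min { hash value of (p,q) : (p,q) ∈ K(T[i,j]) }. (The key set K(T[i,j]) is nonempty since (i,i) ∈ K(T[i,j]).) -/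
/-- `freqIn T t i j` is the number of positions `p` with `i ≤ p ≤ j` and `T p = t`. -/
def freqIn {α : Type*} [DecidableEq α] (T : ℕ → α) (t : α) (i j : ℕ) : ℕ :=
  ((Finset.Icc i j).filter fun p => T p = t).card

/-- The hash value set `H(T[i,j]) = { h(t,x) : t occurs in T[i,j], 1 ≤ x ≤ freq(t, T[i,j]) }`. -/
def hashSet {α : Type*} [DecidableEq α] (T : ℕ → α) (h : α × ℕ → ℕ) (i j : ℕ) : Set ℕ :=
  {v | ∃ t x, 1 ≤ x ∧ x ≤ freqIn T t i j ∧ v = h (t, x)}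

/-- The min-hash of `T[i,j]`, the smallest element of its hash value set. -/
noncomputable def minHash {α : Type*} [DecidableEq α] (T : ℕ → α) (h : α × ℕ → ℕ)
    (i j : ℕ) : ℕ :=
  sInf (hashSet T h i j)

/-- The hash value of a key `(p,q)` of `T`: `h(T(q), freq(T(q), T[p,q]))`. -/
def keyHash {α : Type*} [DecidableEq α] (T : ℕ → α) (h : α × ℕ → ℕ) (p q : ℕ) : ℕ :=
  h (T q, freqIn T (T q) p q)

theorem freqIn_eq_zero {α : Type*} [DecidableEq α] (T : ℕ → α) (t : α) {i j : ℕ} (hij : j < i) :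
    freqIn T t i j = 0 := by
  simp [freqIn, Finset.Icc_eq_empty_of_lt hij]

theorem freqIn_eq_add_left {α : Type*} [DecidableEq α] (T : ℕ → α) (t : α) {i j : ℕ}
    (hij : i ≤ j) :
    freqIn T t i j = freqIn T t (i + 1) j + if T i = t then 1 else 0 := by
  unfold freqIn
  rw [← Finset.insert_Icc_add_one_left_eq_Icc hij, Finset.filter_insert]
  split_ifs <;> simp

theorem freqIn_eq_add_right {α : Type*} [DecidableEq α] (T : ℕ → α) (t : α) {i j : ℕ}
    (hij : i ≤ j + 1) :
    freqIn T t i (j + 1) = freqIn T t i j + if T (j + 1) = t then 1 else 0 := by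
  unfold freqIn
  rw [← Finset.insert_Icc_right_eq_Icc_add_one hij, Finset.filter_insert]
  split_ifs <;> simp

theorem freqIn_mono {α : Type*} [DecidableEq α] (T : ℕ → α) (t : α) {i j p q : ℕ}
    (hip : i ≤ p) (hqj : q ≤ j) : freqIn T t p q ≤ freqIn T t i j :=
  Finset.card_le_card (Finset.filter_subset_filter _ (Finset.Icc_subset_Icc hip hqj))

theorem freqIn_pos {α : Type*} [DecidableEq α] (T : ℕ → α) {p q : ℕ} (hpq : p ≤ q) :
    1 ≤ freqIn T (T q) p q :=
  Finset.card_pos.mpr ⟨q, by simp [hpq]⟩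

/-- Every positive value up to the frequency of `t` in `T[i,j]` is the frequency of `t` in some
`T[p,q]` that starts and ends with `t`. -/
theorem exists_key_freqIn_eq {α : Type*} [DecidableEq α] (T : ℕ → α) (t : α) {x : ℕ}
    (hx : 1 ≤ x) (i j : ℕ) (hxf : x ≤ freqIn T t i j) :
    ∃ p q, i ≤ p ∧ p ≤ q ∧ q ≤ j ∧ T p = t ∧ T q = t ∧ freqIn T t p q = x := by
  induction hd : j + 1 - i generalizing i j with
  | zero =>
    rw [freqIn_eq_zero T t (by omega)] at hxf
    omega
  | succ d ih =>
    have hij : i ≤ j := by omega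
    by_cases hl : x ≤ freqIn T t (i + 1) j
    · obtain ⟨p, q, hp, h⟩ := ih (i + 1) j hl (by omega)
      exact ⟨p, q, by omega, h⟩
    have hleft := freqIn_eq_add_left T t hij
    have hi : T i = t := by
      by_contra hne
      rw [if_neg hne] at hleft
      omega
    rw [if_pos hi] at hleft
    by_cases hj : T j = t
    · exact ⟨i, j, le_rfl, hij, le_rfl, hi, hj, by omega⟩
    obtain _ | j := j
    · obtain rfl : i = 0 := by omega
      exact absurd hi hj
    rw [freqIn_eq_add_right T t (by omega), if_neg hj] at hxf
    obtain ⟨p, q, hp, hpq, hq, h⟩ := ih i j hxf (by omega)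
    exact ⟨p, q, hp, hpq, by omega, h⟩

/-- The hash values of the subsequence are exactly the hash values of its keys. -/
theorem hashSet_eq_setOf_keyHash {α : Type*} [DecidableEq α] (T : ℕ → α) (h : α × ℕ → ℕ)
    (i j : ℕ) :
    hashSet T h i j
      = {v | ∃ p q, i ≤ p ∧ p ≤ q ∧ q ≤ j ∧ T p = T q ∧ v = keyHash T h p q} := by
  ext v
  constructor
  · rintro ⟨t, x, hx, hxf, rfl⟩
    obtain ⟨p, q, hp, hpq, hq, hTp, rfl, rfl⟩ := exists_key_freqIn_eq T t hx i j hxf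
    exact ⟨p, q, hp, hpq, hq, hTp, rfl⟩
  · rintro ⟨p, q, hp, hpq, hq, -, rfl⟩
    exact ⟨T q, _, freqIn_pos T hpq, freqIn_mono T (T q) hp hq, rfl⟩

/-- For any text `T` of length `n`, injective hash function `h`, and `1 ≤ i ≤ j ≤ n`, the
min-hash of `T[i,j]` equals the smallest hash value over the keys in the key set
`K(T[i,j])` (which is nonempty, as `(i,i)` is a key). -/
theorem minHash_eq_min_keyHash {α : Type*} [DecidableEq α] (T : ℕ → α) (n : ℕ)
    (h : α × ℕ → ℕ) (hinj : Function.Injective h)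
    (i j : ℕ) (h1i : 1 ≤ i) (hij : i ≤ j) (hjn : j ≤ n) :
    minHash T h i j
      = sInf {v | ∃ p q, i ≤ p ∧ p ≤ q ∧ q ≤ j ∧ T p = T q ∧ v = keyHash T h p q} := by
  rw [minHash, hashSet_eq_setOf_keyHash]
end

section
/- Let S = S[1], …, S[l] be the skyline of a finite set of keys in coordinate order, and let (b,c) be a key. Let j be the largest index such that S[j].y ≤ c, if such an index exists. Then there exists a key in S that dominates (b,c) if and only if j exists and S[j] dominates (b,c). -/
/-- A key `(p,q)` *dominates* a key `(p',q')` iff `p' ≤ p`, `q ≤ q'`, and the keys are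
distinct. `Dominates s s'` means `s` dominates `s'`. -/
def Dominates (s s' : ℕ × ℕ) : Prop :=
  s'.1 ≤ s.1 ∧ s.2 ≤ s'.2 ∧ s ≠ s'

instance (s s' : ℕ × ℕ) : Decidable (Dominates s s') :=
  inferInstanceAs (Decidable (s'.1 ≤ s.1 ∧ s.2 ≤ s'.2 ∧ s ≠ s'))

/-- The skyline of a finite set `L` of keys: the keys in `L` not dominated by any key in `L`. -/
def skyline (L : Finset (ℕ × ℕ)) : Finset (ℕ × ℕ) :=
  L.filter fun s => ∀ s' ∈ L, ¬ Dominates s' s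

/-- Strict lexicographic order on coordinate pairs. -/
def LexLt (s s' : ℕ × ℕ) : Prop :=
  s.1 < s'.1 ∨ (s.1 = s'.1 ∧ s.2 < s'.2)

/-- No key of a skyline dominates another key of it. -/
theorem not_dominates_of_mem_skyline {L : Finset (ℕ × ℕ)} {s s' : ℕ × ℕ}
    (hs : s ∈ skyline L) (hs' : s' ∈ skyline L) : ¬ Dominates s s' :=
  (Finset.mem_filter.mp hs').2 s (Finset.mem_filter.mp hs).1

theorem LexLt.fst_le {s s' : ℕ × ℕ} (h : LexLt s s') : s.1 ≤ s'.1 :=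
  h.elim le_of_lt fun h => h.1.le

/-- Let `S 1, …, S l` list the skyline of a finite set `L` of keys of a text `T` in
coordinate order, and let `(b,c)` be a key.  Some key of the skyline dominates `(b,c)`
if and only if there is a largest index `j` with `S[j].y ≤ c` and `S[j]` dominates
`(b,c)`. -/
theorem skyline_dominance_binary_search {α : Type*} [DecidableEq α] (T : ℕ → α) (n : ℕ)
    (L : Finset (ℕ × ℕ))
    (hL : ∀ s ∈ L, 1 ≤ s.1 ∧ s.1 ≤ s.2 ∧ s.2 ≤ n ∧ T s.1 = T s.2)
    (l : ℕ) (S : ℕ → ℕ × ℕ)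
    (henum : ∀ s, s ∈ skyline L ↔ ∃ k, 1 ≤ k ∧ k ≤ l ∧ S k = s)
    (hsorted : ∀ k k', 1 ≤ k → k < k' → k' ≤ l → LexLt (S k) (S k'))
    (b c : ℕ) (h1b : 1 ≤ b) (hbc : b ≤ c) (hcn : c ≤ n) (hkey : T b = T c) :
    (∃ s ∈ skyline L, Dominates s (b, c)) ↔
      ∃ j, 1 ≤ j ∧ j ≤ l ∧ (S j).2 ≤ c ∧
        (∀ k, 1 ≤ k → k ≤ l → (S k).2 ≤ c → k ≤ j) ∧
        Dominates (S j) (b, c) := by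
  constructor
  · rintro ⟨s, hs, hdom⟩
    obtain ⟨k, hk1, hkl, rfl⟩ := (henum s).mp hs
    let P : ℕ → Prop := fun i => 1 ≤ i ∧ i ≤ l ∧ (S i).2 ≤ c
    have hPk : P k := ⟨hk1, hkl, hdom.2.1⟩
    obtain ⟨hj1, hjl, hjc⟩ : P (Nat.findGreatest P l) := Nat.findGreatest_spec hkl hPk
    have hmax : ∀ i, 1 ≤ i → i ≤ l → (S i).2 ≤ c → i ≤ Nat.findGreatest P l :=
      fun i hi hil hic => Nat.le_findGreatest hil ⟨hi, hil, hic⟩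
    generalize Nat.findGreatest P l = j at hj1 hjl hjc hmax
    refine ⟨j, hj1, hjl, hjc, hmax, ?_⟩
    rcases (hmax k hk1 hkl hdom.2.1).eq_or_lt with rfl | hkj
    · exact hdom
    · refine ⟨hdom.1.trans (hsorted k j hk1 hkj hjl).fst_le, hjc, fun heq => ?_⟩
      exact not_dominates_of_mem_skyline hs ((henum _).mpr ⟨j, hj1, hjl, rfl⟩) (heq ▸ hdom)
  · rintro ⟨j, hj1, hjl, -, -, hdom⟩
    exact ⟨S j, (henum _).mpr ⟨j, hj1, hjl, rfl⟩, hdom⟩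
end

section
/- Let T be a text of length n, L a finite set of keys of T, and (b,c) a key of T with (b,c) ∉ L. Let S be the augmented skyline of L listed as S[1],…,S[l] in coordinate order. Let i be the largest index such that S[i].y < c and j the smallest index such that S[j].x > b (both exist thanks to the guard keys). Then: if i+1 ≤ j−1, the keys of S dominated by (b,c) are exactly S[i+1], S[i+2], …, S[j−1]; otherwise, no key of S is dominated by (b,c). -/
/-- The augmented skyline of `L` for a text of length `n`: the skyline of `L` together
with the guard keys `(0,0)` and `(n+1,n+1)`. -/
def augSkyline (n : ℕ) (L : Finset (ℕ × ℕ)) : Finset (ℕ × ℕ) :=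
  insert (0, 0) (insert (n + 1, n + 1) (skyline L))

theorem mem_augSkyline {n : ℕ} {L : Finset (ℕ × ℕ)} {s : ℕ × ℕ} :
    s ∈ augSkyline n L ↔ s = (0, 0) ∨ s = (n + 1, n + 1) ∨
      (s ∈ L ∧ ∀ s' ∈ L, ¬ Dominates s' s) := by
  simp [augSkyline, skyline]

/-- Along the coordinate order, the second coordinates in an augmented skyline are monotone. -/
theorem LexLt.snd_le_of_mem_augSkyline {n : ℕ} {L : Finset (ℕ × ℕ)}
    (hL : ∀ s ∈ L, 1 ≤ s.1 ∧ s.1 ≤ n ∧ s.2 ≤ n) {s s' : ℕ × ℕ}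
    (hs : s ∈ augSkyline n L) (hs' : s' ∈ augSkyline n L) (h : LexLt s s') :
    s.2 ≤ s'.2 := by
  by_contra! hlt
  have hfst := h.fst_le
  rcases mem_augSkyline.1 hs with rfl | rfl | ⟨hsL, hmax⟩
  · simp at hlt
  · rcases mem_augSkyline.1 hs' with rfl | rfl | ⟨hsL', -⟩
    · simp at hfst
    · simp at hlt
    · have := hL s' hsL'
      dsimp only at hfst
      omega
  · have hbound := hL s hsL
    rcases mem_augSkyline.1 hs' with rfl | rfl | ⟨hsL', -⟩
    · dsimp only at hfst
      omega
    · dsimp only at hlt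
      omega
    · exact hmax s' hsL' ⟨hfst, hlt.le, fun heq => hlt.ne (congrArg Prod.snd heq)⟩

/-- Let `S 1, …, S l` list the augmented skyline of a finite set `L` of keys of a text
`T` in coordinate order, let `(b,c)` be a key of `T` not in `L`, let `i` be the largest
index with `S[i].y < c`, and let `j` be the smallest index with `S[j].x > b`.  Then the
keys of `S` dominated by `(b,c)` are exactly `S[i+1], …, S[j-1]` (in particular, if
`i + 1 > j - 1` no key of `S` is dominated by `(b,c)`). -/
theorem augSkyline_dominated_range {α : Type*} [DecidableEq α] (T : ℕ → α) (n : ℕ)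
    (L : Finset (ℕ × ℕ))
    (hL : ∀ s ∈ L, 1 ≤ s.1 ∧ s.1 ≤ s.2 ∧ s.2 ≤ n ∧ T s.1 = T s.2)
    (b c : ℕ) (h1b : 1 ≤ b) (hbc : b ≤ c) (hcn : c ≤ n) (hkey : T b = T c)
    (hbcL : (b, c) ∉ L)
    (l : ℕ) (S : ℕ → ℕ × ℕ)
    (henum : ∀ s, s ∈ augSkyline n L ↔ ∃ k, 1 ≤ k ∧ k ≤ l ∧ S k = s)
    (hsorted : ∀ k k', 1 ≤ k → k < k' → k' ≤ l → LexLt (S k) (S k'))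
    (i j : ℕ)
    (hi : 1 ≤ i ∧ i ≤ l ∧ (S i).2 < c ∧ ∀ k, 1 ≤ k → k ≤ l → (S k).2 < c → k ≤ i)
    (hj : 1 ≤ j ∧ j ≤ l ∧ b < (S j).1 ∧ ∀ k, 1 ≤ k → k ≤ l → b < (S k).1 → j ≤ k) :
    ∀ k, 1 ≤ k → k ≤ l → (Dominates (b, c) (S k) ↔ (i < k ∧ k < j)) := by
  obtain ⟨hi1, hil, hic, himax⟩ := hi
  obtain ⟨hj1, hjl, hjb, hjmin⟩ := hj
  have hmem : ∀ k, 1 ≤ k → k ≤ l → S k ∈ augSkyline n L :=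
    fun k h1 h2 => (henum _).2 ⟨k, h1, h2, rfl⟩
  have hL' : ∀ s ∈ L, 1 ≤ s.1 ∧ s.1 ≤ n ∧ s.2 ≤ n := fun s hs => by
    have := hL s hs
    omega
  have hnot : (b, c) ∉ augSkyline n L := by
    rw [mem_augSkyline]
    rintro (h | h | h)
    · simp only [Prod.mk.injEq] at h
      omega
    · simp only [Prod.mk.injEq] at h
      omega
    · exact hbcL h.1
  intro k hk1 hkl
  constructor
  · rintro ⟨hx, hy, -⟩
    dsimp only at hx hy
    constructor
    · by_contra! hki
      rcases hki.eq_or_lt with rfl | hki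
      · omega
      · have := (hsorted k i hk1 hki hil).snd_le_of_mem_augSkyline hL'
          (hmem k hk1 hkl) (hmem i hi1 hil)
        omega
    · by_contra! hjk
      rcases hjk.eq_or_lt with rfl | hjk
      · omega
      · have := (hsorted j k hj1 hjk hkl).fst_le
        omega
  · rintro ⟨hik, hkj⟩
    refine ⟨?_, ?_, fun heq => hnot (heq ▸ hmem k hk1 hkl)⟩
    · by_contra! h
      exact hkj.not_ge (hjmin k hk1 hkl h)
    · by_contra! h
      exact hik.not_ge (himax k hk1 hkl h)
end

section
/- Let T be a text of length n, let t be a token occurring exactly f times in T (f = freq(t, T[1,n])), and let x be an integer with 1 ≤ x ≤ f. Then the number of keys (p,q) of T with T(p) = T(q) = t and freq(t, T[p,q]) = x is exactly f − x + 1. -/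
theorem freqIn_mono_right {α : Type*} [DecidableEq α] (T : ℕ → α) (t : α) (i : ℕ) {j k : ℕ}
    (h : j ≤ k) : freqIn T t i j ≤ freqIn T t i k :=
  Finset.card_le_card (Finset.filter_subset_filter _ (Finset.Icc_subset_Icc_right h))

theorem freqIn_pos_s14 {α : Type*} [DecidableEq α] {T : ℕ → α} {t : α} {i j p : ℕ}
    (hip : i ≤ p) (hpj : p ≤ j) (hp : T p = t) : 0 < freqIn T t i j :=
  Finset.card_pos.2 ⟨p, by simp [hip, hpj, hp]⟩

/-- Splitting a range at an occurrence `p` of `t` counts `p` twice. -/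
theorem freqIn_add_freqIn {α : Type*} [DecidableEq α] {T : ℕ → α} {t : α} {i p q : ℕ}
    (hip : i ≤ p) (hpq : p ≤ q) (hp : T p = t) :
    freqIn T t i p + freqIn T t p q = freqIn T t i q + 1 := by
  unfold freqIn
  rw [← Finset.card_union_add_card_inter]
  congr 1
  · congr 1
    ext a
    simp only [Finset.mem_union, Finset.mem_filter, Finset.mem_Icc]
    grind
  · rw [Finset.card_eq_one]
    refine ⟨p, ?_⟩
    ext a
    simp only [Finset.mem_inter, Finset.mem_filter, Finset.mem_Icc, Finset.mem_singleton]
    grind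

theorem freqIn_lt_freqIn {α : Type*} [DecidableEq α] {T : ℕ → α} {t : α} {i p q : ℕ}
    (hip : i ≤ p) (hpq : p < q) (hq : T q = t) : freqIn T t i p < freqIn T t i q := by
  refine Finset.card_lt_card (Finset.ssubset_iff_of_subset
    (Finset.filter_subset_filter _ (Finset.Icc_subset_Icc_right hpq.le)) |>.2 ⟨q, ?_, ?_⟩)
  · simp [hq, hip.trans hpq.le]
  · simp [hpq]

/-- The number of occurrences up to an occurrence determines that occurrence. -/
theorem eq_of_freqIn_eq {α : Type*} [DecidableEq α] {T : ℕ → α} {t : α} {i p q : ℕ}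
    (hip : i ≤ p) (hiq : i ≤ q) (hp : T p = t) (hq : T q = t)
    (h : freqIn T t i p = freqIn T t i q) : p = q := by
  rcases lt_trichotomy p q with hlt | heq | hlt
  · exact absurd h (freqIn_lt_freqIn hip hlt hq).ne
  · exact heq
  · exact absurd h.symm (freqIn_lt_freqIn hiq hlt hp).ne

/-- The `k`-th occurrence of `t` exists for every `k` up to the total number of occurrences. -/
theorem exists_freqIn_eq {α : Type*} [DecidableEq α] {T : ℕ → α} {t : α} {i j k : ℕ}
    (hk : 1 ≤ k) (hkj : k ≤ freqIn T t i j) :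
    ∃ p, i ≤ p ∧ p ≤ j ∧ T p = t ∧ freqIn T t i p = k := by
  have hsurj := Finset.surj_on_of_inj_on_of_card_le
    (s := (Finset.Icc i j).filter fun p => T p = t) (t := Finset.Icc 1 (freqIn T t i j))
    (fun p _ => freqIn T t i p)
    (fun p hp => by
      simp only [Finset.mem_filter, Finset.mem_Icc] at hp
      exact Finset.mem_Icc.2
        ⟨freqIn_pos_s14 hp.1.1 le_rfl hp.2, freqIn_mono_right T t i hp.1.2⟩)
    (fun p q hp hq h => by
      simp only [Finset.mem_filter, Finset.mem_Icc] at hp hq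
      exact eq_of_freqIn_eq hp.1.1 hq.1.1 hp.2 hq.2 h)
    (by simp [freqIn])
  obtain ⟨p, hp, rfl⟩ := hsurj k (Finset.mem_Icc.2 ⟨hk, hkj⟩)
  simp only [Finset.mem_filter, Finset.mem_Icc] at hp
  exact ⟨p, hp.1.1, hp.1.2, hp.2, rfl⟩

/-- Let `T` be a text of length `n` in which the token `t` occurs exactly `f` times, and
let `1 ≤ x ≤ f`.  The number of keys `(p,q)` of `T` with `T p = T q = t` and
`freq(t, T[p,q]) = x` is exactly `f − x + 1`. -/
theorem count_keys_of_frequency {α : Type*} [DecidableEq α] (T : ℕ → α) (n : ℕ)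
    (t : α) (f x : ℕ) (hf : freqIn T t 1 n = f) (h1x : 1 ≤ x) (hxf : x ≤ f) :
    ((Finset.Icc 1 n ×ˢ Finset.Icc 1 n).filter fun pq =>
        pq.1 ≤ pq.2 ∧ T pq.1 = t ∧ T pq.2 = t ∧ freqIn T t pq.1 pq.2 = x).card
      = f - x + 1 := by
  rw [← Nat.add_sub_cancel (f - x + 1) 1, ← Nat.card_Icc 1 (f - x + 1)]
  refine Finset.card_bij (fun pq _ => freqIn T t 1 pq.1) ?_ ?_ ?_
  · rintro ⟨p, q⟩ h
    simp only [Finset.mem_filter, Finset.mem_product, Finset.mem_Icc] at h ⊢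
    obtain ⟨⟨⟨hp1, hpn⟩, hq1, hqn⟩, hpq, hp, hq, hx⟩ := h
    have hadd := freqIn_add_freqIn hp1 hpq hp
    have hle := freqIn_mono_right T t 1 hqn
    have hpos := freqIn_pos_s14 hp1 le_rfl hp
    omega
  · rintro ⟨p, q⟩ h ⟨p', q'⟩ h' heq
    simp only [Finset.mem_filter, Finset.mem_product, Finset.mem_Icc] at h h' heq
    obtain ⟨⟨⟨hp1, -⟩, hq1, -⟩, hpq, hp, hq, hx⟩ := h
    obtain ⟨⟨⟨hp1', -⟩, hq1', -⟩, hpq', hp', hq', hx'⟩ := h'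
    have hadd := freqIn_add_freqIn hp1 hpq hp
    have hadd' := freqIn_add_freqIn hp1' hpq' hp'
    rw [eq_of_freqIn_eq hp1 hp1' hp hp' heq,
      eq_of_freqIn_eq hq1 hq1' hq hq' (by omega)]
  · intro k hk
    rw [Finset.mem_Icc] at hk
    obtain ⟨p, hp1, hpn, hp, hpk⟩ :=
      exists_freqIn_eq (T := T) (t := t) (i := 1) (j := n) hk.1 (by omega)
    obtain ⟨q, hq1, hqn, hq, hqk⟩ :=
      exists_freqIn_eq (T := T) (t := t) (i := 1) (j := n) (k := k + x - 1)
        (by omega) (by omega)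
    have hpq : p ≤ q := by
      by_contra! hlt
      have := freqIn_lt_freqIn hq1 hlt hp
      omega
    have hadd := freqIn_add_freqIn hp1 hpq hp
    refine ⟨(p, q), ?_, hpk⟩
    simp only [Finset.mem_filter, Finset.mem_product, Finset.mem_Icc]
    exact ⟨⟨⟨hp1, hpn⟩, hq1, hqn⟩, hpq, hp, hq, by omega⟩
end
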